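/- Let i, j with |i−j| > 1 and let x be a Kostant partition with f_i(x) ≠ 0. Then φ_j(f_i(x)) = φ_j(x) (Stembridge axiom S1' for the modified operators in the orthogonal case). -/

import Mathlib

open scoped BigOperators

namespace KFC

/-- A (candidate) root is a pair of 1-based indices. -/
abbrev Root : Type := ℕ × ℕ

/-- A Kostant partition is encoded as a multiplicity function on pairs. -/
abbrev KPf : Type := Root → ℕ

/-- An entry of a signed word: a sign (`true` = '+', `false` = '−') together
with the root lying under it. -/
abbrev Entry : Type := Bool × Root

/-- `p` is a positive root of type `A_{n-1}`. -/
def IsPos (n : ℕ) (p : Root) : Prop := 1 ≤ p.1 ∧ p.1 < p.2 ∧ p.2 ≤ n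

/-- `α` is a genuine Kostant partition for type `A_{n-1}`: it is supported on
positive roots. -/
def IsKP (n : ℕ) (α : KPf) : Prop := ∀ p, α p ≠ 0 → IsPos n p

/-- Add one copy of the root `r`. -/
def KPadd (α : KPf) (r : Root) : KPf := fun p => if p = r then α p + 1 else α p

/-- Remove one copy of the root `r`. -/
def KPsub (α : KPf) (r : Root) : KPf := fun p => if p = r then α p - 1 else α p

/-- Replace one copy of `r` by one copy of `r'`. -/
def KPmove (α : KPf) (r r' : Root) : KPf := KPadd (KPsub α r) r'

/-- The signed word `W_i` of `α`: roots `(a,b)` ordered by decreasing `a` and,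
for equal `a`, increasing `b`; a '+' under each `(h,i)` and a '−' under each
`(h,i+1)`. -/
def Wword (n i : ℕ) (α : KPf) : List Entry :=
  ((List.range (n+1)).reverse).flatMap (fun h =>
    List.replicate (α (h, i)) ((true, (h, i)) : Entry) ++
    List.replicate (α (h, i+1)) ((false, (h, i+1)) : Entry))

/-- The signed word `W_i*` of `α`: roots `(a,b)` ordered by increasing `b` and,
for equal `b`, decreasing `a`; a '+' under each `(i+1,j)` and a '−' under each
`(i,j)`. -/
def Wstar (n i : ℕ) (α : KPf) : List Entry :=
  (List.range (n+1)).flatMap (fun j =>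
    List.replicate (α (i+1, j)) ((true, (i+1, j)) : Entry) ++
    List.replicate (α (i, j)) ((false, (i, j)) : Entry))

/-- One step of the left-to-right reduction: a new '+' cancels the rightmost
surviving '−' (the surviving word always has the shape `+^a −^b`). -/
def redStep (s : List Entry) (e : Entry) : List Entry :=
  match e.1, s.getLast? with
  | true, some (false, _) => s.dropLast
  | _, _ => s ++ [e]

/-- The reduced word (list of surviving entries, in order). -/
def reduceW (w : List Entry) : List Entry := w.foldl redStep []

def plusCt (w : List Entry) : ℕ := (w.filter (fun e => e.1)).length
def minusCt (w : List Entry) : ℕ := (w.filter (fun e => !e.1)).length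

/-- `a_i`: number of '+' in the reduced word of `W_i`. -/
def aSt (n i : ℕ) (α : KPf) : ℕ := plusCt (reduceW (Wword n i α))
/-- `b_i`: number of '−' in the reduced word of `W_i`. -/
def bSt (n i : ℕ) (α : KPf) : ℕ := minusCt (reduceW (Wword n i α))
/-- `a_i*`. -/
def aStar (n i : ℕ) (α : KPf) : ℕ := plusCt (reduceW (Wstar n i α))
/-- `b_i*`. -/
def bStar (n i : ℕ) (α : KPf) : ℕ := minusCt (reduceW (Wstar n i α))
/-- `u_i`: number of '+' in the reduced word of `W_i* W_i`. -/
def uSt (n i : ℕ) (α : KPf) : ℕ := plusCt (reduceW (Wstar n i α ++ Wword n i α))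
/-- `v_i`: number of '−' in the reduced word of `W_i* W_i`. -/
def vSt (n i : ℕ) (α : KPf) : ℕ := minusCt (reduceW (Wstar n i α ++ Wword n i α))

/-- The root under the rightmost surviving '+'. -/
def lastPlus (w : List Entry) : Option Root :=
  (((reduceW w).filter (fun e => e.1)).getLast?).map Prod.snd

/-- The root under the leftmost surviving '−'. -/
def headMinus (w : List Entry) : Option Root :=
  (((reduceW w).filter (fun e => !e.1)).head?).map Prod.snd

/-- The operator `f̃_i`. -/
def ftilde (n i : ℕ) (α : KPf) : Option KPf :=
  match lastPlus (Wword n i α) with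
  | some r => some (KPmove α r (r.1, i+1))
  | none => some (KPadd α (i, i+1))

/-- The operator `ẽ_i`. -/
def etilde (n i : ℕ) (α : KPf) : Option KPf :=
  match headMinus (Wword n i α) with
  | some r => if r = (i, i+1) then some (KPsub α (i, i+1)) else some (KPmove α r (r.1, i))
  | none => none

/-- The operator `f̃_i*`. -/
def ftildeS (n i : ℕ) (α : KPf) : Option KPf :=
  match lastPlus (Wstar n i α) with
  | some r => some (KPmove α r (i, r.2))
  | none => some (KPadd α (i, i+1))

/-- The operator `ẽ_i*`. -/
def etildeS (n i : ℕ) (α : KPf) : Option KPf :=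
  match headMinus (Wstar n i α) with
  | some r => if r = (i, i+1) then some (KPsub α (i, i+1)) else some (KPmove α r (i+1, r.2))
  | none => none

/-- The modified operator `f_i`. -/
def fop (n i : ℕ) (α : KPf) : Option KPf :=
  if bStar n i α < aSt n i α then ftilde n i α
  else if 0 < aStar n i α then ftildeS n i α
  else none

/-- The modified operator `e_i`. -/
def eop (n i : ℕ) (α : KPf) : Option KPf :=
  if bStar n i α ≤ aSt n i α then
    (if 0 < bSt n i α ∧ headMinus (Wword n i α) ≠ some (i, i+1) then etilde n i α else none)
  else
    (if headMinus (Wstar n i α) ≠ some (i, i+1) then etildeS n i α else none)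

/-- The operator `ê_i`. -/
def ehat (n i : ℕ) (α : KPf) : Option KPf :=
  if bStar n i α ≤ aSt n i α then (if 0 < bSt n i α then etilde n i α else none)
  else etildeS n i α

/-- Iterate a partially defined operator (`none` plays the role of `0`). -/
def iterO (g : KPf → Option KPf) : ℕ → KPf → Option KPf
  | 0, x => some x
  | k+1, x => (g x).bind (iterO g k)

/-- `ε_i(x) = max {k : e_i^k x ≠ 0}`. -/
noncomputable def epsS (n i : ℕ) (x : KPf) : ℕ := sSup {k | iterO (eop n i) k x ≠ none}
/-- `ε̂_i(x) = max {k : ê_i^k x ≠ 0}`. -/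
noncomputable def epsHatS (n i : ℕ) (x : KPf) : ℕ := sSup {k | iterO (ehat n i) k x ≠ none}
/-- `φ_i(x) = max {k : f_i^k x ≠ 0}`. -/
noncomputable def phiS (n i : ℕ) (x : KPf) : ℕ := sSup {k | iterO (fop n i) k x ≠ none}

noncomputable def epsO (n i : ℕ) (o : Option KPf) : ℕ := o.elim 0 (epsS n i)
noncomputable def epsHatO (n i : ℕ) (o : Option KPf) : ℕ := o.elim 0 (epsHatS n i)
noncomputable def phiO (n i : ℕ) (o : Option KPf) : ℕ := o.elim 0 (phiS n i)

/-- `e_l(γ) ≃ 0`. -/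
def simZero (n l : ℕ) (γ : KPf) : Prop := eop n l γ ≠ ehat n l γ

/-- `e_l e_m (γ) ≃ 0`. -/
def simZero2 (n l m : ℕ) (γ : KPf) : Prop := ∃ δ, eop n m γ = some δ ∧ simZero n l δ

/-- The box containing all relevant pairs. -/
def kbox (n : ℕ) : Finset (ℕ × ℕ) := Finset.range (n+1) ×ˢ Finset.range (n+1)

/-- `|α|`: number of parts of the Kostant partition. -/
def kpSize (n : ℕ) (α : KPf) : ℕ := ∑ p ∈ kbox n, α p

/-- The evaluation `ᾱ ∈ ℤ^n` (as a function on 1-based coordinates). -/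
def kpEval (n : ℕ) (α : KPf) : ℕ → ℤ :=
  fun k => ∑ p ∈ kbox n, (α p : ℤ) * ((if p.1 = k then 1 else 0) - (if p.2 = k then 1 else 0))

/-- The simple root `α_i = ε_i − ε_{i+1}` as a vector. -/
def srVec (i : ℕ) : ℕ → ℤ := fun k => (if k = i then 1 else 0) - (if k = i+1 then 1 else 0)

/-- `ρ = (n-1, n-2, …, 1, 0)` (on 1-based coordinates `1..n`). -/
def rhoVec (n : ℕ) : ℕ → ℤ := fun k => (n : ℤ) - k

/-- `⟨γ, α_i^∨⟩ = γ_i − γ_{i+1}`. -/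
def pairCo (γ : ℕ → ℤ) (i : ℕ) : ℤ := γ i - γ (i+1)

/-- The permutation of 1-based coordinates induced by `w : Perm (Fin n)`. -/
def extP (n : ℕ) (w : Equiv.Perm (Fin n)) (k : ℕ) : ℕ :=
  if h : 1 ≤ k ∧ k ≤ n then ((w ⟨k - 1, by omega⟩ : Fin n) : ℕ) + 1 else k

/-- `S_n` acting on `ℤ^n` by permuting coordinates: `(w·v)_k = v_{w⁻¹(k)}`. -/
def permAct (n : ℕ) (w : Equiv.Perm (Fin n)) (v : ℕ → ℤ) : ℕ → ℤ :=
  fun k => v (extP n w⁻¹ k)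

/-- The simple transposition `s_i = (i, i+1)` (1-based). -/
def sT (n i : ℕ) : Equiv.Perm (Fin n) :=
  if h : 1 ≤ i ∧ i < n then Equiv.swap ⟨i - 1, by omega⟩ ⟨i, h.2⟩ else 1

/-- Coxeter length = number of inversions. -/
def lenP (n : ℕ) (w : Equiv.Perm (Fin n)) : ℕ :=
  (Finset.univ.filter (fun p : Fin n × Fin n => p.1 < p.2 ∧ w p.2 < w p.1)).card

/-- The left weak Bruhat order: `u ≤ w` iff `ℓ(w) = ℓ(w u⁻¹) + ℓ(u)`. -/
def leftWeakLE (n : ℕ) (u w : Equiv.Perm (Fin n)) : Prop :=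
  lenP n w = lenP n (w * u⁻¹) + lenP n u

/-- `λ + ρ` as a vector. -/
def lamRho (n : ℕ) (lam : ℕ → ℤ) : ℕ → ℤ := fun k => lam k + rhoVec n k

/-- `(w, α) ∈ S_{λ,μ}`, i.e. `ᾱ = w(λ+ρ) − (μ+ρ)`. -/
def InS (n : ℕ) (lam mu : ℕ → ℤ) (w : Equiv.Perm (Fin n)) (α : KPf) : Prop :=
  IsKP n α ∧ ∀ k, 1 ≤ k → k ≤ n →
    kpEval n α k = permAct n w (lamRho n lam) k - (mu k + rhoVec n k)

/-- A directed edge `(w,α) →^i (s_i w, β)` of the `Φ`-graph. -/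
def PhiEdge (n : ℕ) (lam mu : ℕ → ℤ) (v v' : Equiv.Perm (Fin n) × KPf) : Prop :=
  InS n lam mu v.1 v.2 ∧ InS n lam mu v'.1 v'.2 ∧
  ∃ i, 1 ≤ i ∧ i ≤ n - 1 ∧
    pairCo (permAct n v.1 (lamRho n lam)) i < 0 ∧
    v'.1 = sT n i * v.1 ∧
    iterO (fop n i) (-(pairCo (permAct n v.1 (lamRho n lam)) i)).toNat v.2 = some v'.2

/-- Being in the same connected component of (the underlying undirected graph of)
the `Φ`-graph. -/
def Conn (n : ℕ) (lam mu : ℕ → ℤ) (v v' : Equiv.Perm (Fin n) × KPf) : Prop :=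
  Relation.ReflTransGen (fun a b => PhiEdge n lam mu a b ∨ PhiEdge n lam mu b a) v v'

/-- `(w,β)` has a broken hexagon, broken by `Φ_i` after `Φ_j`. -/
def BrokenHexAt (n : ℕ) (lam mu : ℕ → ℤ) (w : Equiv.Perm (Fin n)) (β : KPf) (i j : ℕ) : Prop :=
  (j = i + 1 ∨ i = j + 1) ∧ 1 ≤ i ∧ i ≤ n - 1 ∧ 1 ≤ j ∧ j ≤ n - 1 ∧
  0 < pairCo (permAct n w (lamRho n lam)) i ∧
  0 < pairCo (permAct n w (lamRho n lam)) j ∧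
  iterO (eop n i) (pairCo (permAct n w (lamRho n lam)) i).toNat β ≠ none ∧
  ∃ δ, iterO (eop n j) (pairCo (permAct n w (lamRho n lam)) j).toNat β = some δ ∧
    epsS n i δ < (pairCo (permAct n w (lamRho n lam)) i).toNat +
      (pairCo (permAct n w (lamRho n lam)) j).toNat

/-- `γ` is obtained from `β` by an initial segment of the operator sequence
(`e_i` applied `ki` times, then `e_j` applied `ki+kj` times, then `e_i` applied
`kj` times). -/
def alongPath (n i j ki kj : ℕ) (β γ : KPf) : Prop :=
  (∃ a ≤ ki, iterO (eop n i) a β = some γ) ∨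
  (∃ b ≤ ki + kj, (iterO (eop n i) ki β).bind (iterO (eop n j) b) = some γ) ∨
  (∃ c ≤ kj, ((iterO (eop n i) ki β).bind (iterO (eop n j) (ki + kj))).bind
      (iterO (eop n i) c) = some γ)

/-- Conjecture A: no broken diamonds along the hexagon paths. -/
def ConjA (n : ℕ) (lam mu : ℕ → ℤ) : Prop :=
  ∀ (w : Equiv.Perm (Fin n)) (β : KPf) (i j : ℕ),
    InS n lam mu w β → 1 ≤ i → i ≤ n - 1 → 1 ≤ j → j ≤ n - 1 → (j = i + 1 ∨ i = j + 1) →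
    ∀ ki kj : ℤ,
      ki = pairCo (permAct n w (lamRho n lam)) i →
      kj = pairCo (permAct n w (lamRho n lam)) j →
      0 < ki → 0 < kj →
      iterO (eop n i) ki.toNat β ≠ none → iterO (eop n j) kj.toNat β ≠ none →
      ∀ γ : KPf,
        (alongPath n i j ki.toNat kj.toNat β γ ∨ alongPath n j i kj.toNat ki.toNat β γ) →
        ¬ (simZero2 n i j γ ∧ simZero2 n j i γ)

/-- Conjecture B: broken hexagons propagate up to the source vertex. -/
def ConjB (n : ℕ) (lam mu : ℕ → ℤ) : Prop :=
  ∀ (w : Equiv.Perm (Fin n)) (β α : KPf) (i j : ℕ),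
    InS n lam mu w β → InS n lam mu 1 α → Conn n lam mu (1, α) (w, β) →
    BrokenHexAt n lam mu w β i j → ∃ j', BrokenHexAt n lam mu 1 α i j'

/-- The Kostka–Foulkes polynomial `K_{λ,μ}(t) = Σ_{(w,α) ∈ S_{λ,μ}} sgn(w) t^{|α|}`. -/
noncomputable def KF (n : ℕ) (lam mu : ℕ → ℤ) : Polynomial ℤ :=
  ∑ᶠ (w : Equiv.Perm (Fin n)) (α : KPf) (_ : InS n lam mu w α),
    ((Equiv.Perm.sign w : ℤ) • (Polynomial.X ^ kpSize n α) : Polynomial ℤ)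

end KFC

namespace KFC

/-- Number of surviving '+' contributed by the blocks `(+)^{p h}(−)^{m h}`, `h ∈ L`, when `b`
uncancelled '−' precede them. -/
def gain (p m : ℕ → ℕ) : ℕ → List ℕ → ℕ
  | _, [] => 0
  | b, h :: L => (p h - b) + gain p m (b - p h + m h) L

/-- Number of surviving '−' after the blocks `(+)^{p h}(−)^{m h}`, `h ∈ L`, when `b`
uncancelled '−' precede them. -/
def rest (p m : ℕ → ℕ) : ℕ → List ℕ → ℕ
  | b, [] => b
  | b, h :: L => rest p m (b - p h + m h) L

/-- The rightmost surviving '+' of the blocks indexed by `L` lies in block `h`. -/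
def LastSurvivor (p m : ℕ → ℕ) (L : List ℕ) (h : ℕ) : Prop :=
  ∃ L₁ L₂, L = L₁ ++ h :: L₂ ∧ rest p m 0 L₁ < p h ∧ gain p m (m h) L₂ = 0

/-- The signed word with blocks `(+)^{p h}(−)^{m h}`, `h ∈ L`. -/
def blockWord (p m : ℕ → ℕ) (rp rm : ℕ → Root) (L : List ℕ) : List Entry :=
  L.flatMap fun h =>
    List.replicate (p h) ((true, rp h) : Entry) ++ List.replicate (m h) ((false, rm h) : Entry)

section Blocks

variable {p m p' m' : ℕ → ℕ}

lemma gain_append (b : ℕ) (L₁ L₂ : List ℕ) :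
    gain p m b (L₁ ++ L₂) = gain p m b L₁ + gain p m (rest p m b L₁) L₂ := by
  induction L₁ generalizing b with
  | nil => simp [gain, rest]
  | cons h L ih => simp [gain, rest, ih, Nat.add_assoc]

lemma rest_append (b : ℕ) (L₁ L₂ : List ℕ) :
    rest p m b (L₁ ++ L₂) = rest p m (rest p m b L₁) L₂ := by
  induction L₁ generalizing b with
  | nil => simp [rest]
  | cons h L ih => simp [rest, ih]

lemma gain_rest_congr {L : List ℕ} (hL : ∀ h ∈ L, p' h = p h ∧ m' h = m h) (b : ℕ) :
    gain p' m' b L = gain p m b L ∧ rest p' m' b L = rest p m b L := by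
  induction L generalizing b with
  | nil => simp [gain, rest]
  | cons h L ih =>
    obtain ⟨h1, h2⟩ := hL h (by simp)
    have := ih (fun k hk => hL k (by simp [hk])) (b - p h + m h)
    simp [gain, rest, h1, h2, this]

lemma gain_rest_succ {L : List ℕ} {b : ℕ} (hL : gain p m b L = 0) :
    gain p m (b + 1) L = 0 ∧ rest p m (b + 1) L = rest p m b L + 1 := by
  induction L generalizing b with
  | nil => simp [gain, rest]
  | cons h L ih =>
    simp only [gain, rest] at hL ⊢
    have := ih (b := b - p h + m h) (by omega)
    rw [show b + 1 - p h + m h = b - p h + m h + 1 by omega]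
    omega

lemma LastSurvivor.move {L : List ℕ} {h : ℕ} (hs : LastSurvivor p m L h) (hL : L.Nodup)
    (hp : p' h + 1 = p h) (hm : m' h = m h + 1)
    (hne : ∀ k, k ≠ h → p' k = p k ∧ m' k = m k) :
    gain p' m' 0 L + 1 = gain p m 0 L ∧ rest p' m' 0 L = rest p m 0 L + 1 := by
  obtain ⟨L₁, L₂, rfl, h1, h2⟩ := hs
  rw [List.nodup_middle, List.nodup_cons, List.mem_append, not_or] at hL
  have e1 := gain_rest_congr (p := p) (m := m) (p' := p') (m' := m') (L := L₁)
    (fun k hk => hne k (fun e => hL.1.1 (e ▸ hk))) 0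
  have e2 := gain_rest_congr (p := p) (m := m) (p' := p') (m' := m') (L := L₂)
    (fun k hk => hne k (fun e => hL.1.2 (e ▸ hk))) (m h + 1)
  have e3 := gain_rest_succ h2
  simp only [gain_append, rest_append, gain, rest, e1.1, e1.2]
  rw [show rest p m 0 L₁ - p' h + m' h = m h + 1 by omega,
    show rest p m 0 L₁ - p h + m h = m h by omega, e2.1, e2.2]
  omega

lemma LastSurvivor.adjacent {R₁ R₂ : List ℕ} {u v h : ℕ}
    (hs : LastSurvivor p m (R₁ ++ u :: v :: R₂) h) (hL : (R₁ ++ u :: v :: R₂).Nodup) :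
    (h = u → p v ≤ m u) ∧ (h = v → m u < p v) := by
  obtain ⟨L₁, L₂, e, h1, h2⟩ := hs
  have hL' := hL
  rw [List.nodup_middle, List.nodup_cons, List.mem_append, not_or] at hL'
  constructor
  · rintro rfl
    obtain ⟨rfl, rfl⟩ := (List.append_cons_inj_of_notMem hL'.1.1 hL'.1.2).1 e |>.imp id And.right
    simp only [gain] at h2
    omega
  · rintro rfl
    have e' : (R₁ ++ [u]) ++ h :: R₂ = L₁ ++ h :: L₂ := by simpa using e
    have hL₁ : (R₁ ++ [u]) ++ h :: R₂ = R₁ ++ u :: h :: R₂ := by simp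
    rw [← hL₁, List.nodup_middle, List.nodup_cons, List.mem_append, not_or] at hL
    obtain ⟨rfl, -⟩ := (List.append_cons_inj_of_notMem hL.1.1 hL.1.2).1 e' |>.imp id And.right
    simp only [rest_append, rest] at h1
    omega

lemma gain_rest_of_adjacent {R₁ R₂ : List ℕ} {u v : ℕ} (hL : (R₁ ++ u :: v :: R₂).Nodup)
    (hne : ∀ k, k ≠ u → k ≠ v → p' k = p k ∧ m' k = m k)
    (huv : (p' u + 1 = p u ∧ p' v = p v + 1 ∧ m' u = m u ∧ m' v = m v ∧ m u ≤ p v) ∨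
      (m' u + 1 = m u ∧ m' v = m v + 1 ∧ p' u = p u ∧ p' v = p v ∧ p v < m u)) :
    gain p' m' 0 (R₁ ++ u :: v :: R₂) = gain p m 0 (R₁ ++ u :: v :: R₂) ∧
      rest p' m' 0 (R₁ ++ u :: v :: R₂) = rest p m 0 (R₁ ++ u :: v :: R₂) := by
  have hmem : ∀ k ∈ R₁ ++ R₂, k ≠ u ∧ k ≠ v := by
    intro k hk
    constructor <;> rintro rfl <;> simp [List.nodup_append] at hL hk <;> grind
  have e1 := gain_rest_congr (p := p) (m := m) (p' := p') (m' := m') (L := R₁)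
    (fun k hk => hne k (hmem k (by simp [hk])).1 (hmem k (by simp [hk])).2) 0
  have e2 := gain_rest_congr (p := p) (m := m) (p' := p') (m' := m') (L := R₂)
    (fun k hk => hne k (hmem k (by simp [hk])).1 (hmem k (by simp [hk])).2)
  simp only [gain_append, rest_append, gain, rest, e1.1, e1.2, e2]
  generalize rest p m 0 R₁ = b
  have hb : b - p' u + m' u - p' v + m' v = b - p u + m u - p v + m v := by omega
  rw [hb]
  omega

end Blocks

section Reduction

lemma foldl_redStep_plus (r : Root) (k : ℕ) (P M : List Entry) (hP : ∀ e ∈ P, e.1 = true)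
    (hM : ∀ e ∈ M, e.1 = false) :
    (List.replicate k ((true, r) : Entry)).foldl redStep (P ++ M) =
      (P ++ List.replicate (k - M.length) (true, r)) ++ M.take (M.length - k) := by
  induction k generalizing P M with
  | zero => simp
  | succ k ih =>
    rw [List.replicate_succ, List.foldl_cons]
    rcases List.eq_nil_or_concat M with rfl | ⟨M', e, rfl⟩
    · have : redStep (P ++ []) (true, r) = (P ++ [(true, r)]) ++ [] := by
        rcases List.eq_nil_or_concat P with rfl | ⟨P', e, rfl⟩
        · rfl
        · have he := hP e (by simp)
          obtain ⟨s, q⟩ := e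
          simp only at he
          subst he
          simp [redStep]
      rw [this, ih _ _ (by simpa [or_imp, forall_and] using hP) (by simp)]
      simp [List.replicate_succ]
    · have he := hM e (by simp)
      obtain ⟨s, q⟩ := e
      simp only at he
      subst he
      have : redStep (P ++ (M'.concat (false, q))) (true, r) = P ++ M' := by
        simp [redStep, ← List.append_assoc]
      rw [this, ih _ _ hP (fun e he => hM e (by simp [he]))]
      simp [List.take_append]

lemma foldl_redStep_minus (r : Root) (k : ℕ) (s : List Entry) :
    (List.replicate k ((false, r) : Entry)).foldl redStep s =
      s ++ List.replicate k (false, r) := by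
  induction k generalizing s with
  | zero => simp
  | succ k ih =>
    rw [List.replicate_succ, List.foldl_cons, ih]
    simp [redStep]

lemma reduceW_blockWord (p m : ℕ → ℕ) (rp rm : ℕ → Root) (L : List ℕ) :
    ∃ P M, reduceW (blockWord p m rp rm L) = P ++ M ∧ (∀ e ∈ P, e.1 = true) ∧
      (∀ e ∈ M, e.1 = false) ∧ P.length = gain p m 0 L ∧ M.length = rest p m 0 L ∧
      (P = [] ∨ ∃ h, LastSurvivor p m L h ∧ P.getLast? = some (true, rp h)) := by
  induction L using List.reverseRecOn with
  | nil => exact ⟨[], [], by simp [reduceW, blockWord, gain, rest]⟩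
  | append_singleton L h ih =>
    obtain ⟨P, M, e, hP, hM, lP, lM, hl⟩ := ih
    refine ⟨P ++ List.replicate (p h - M.length) (true, rp h),
      M.take (M.length - p h) ++ List.replicate (m h) (false, rm h), ?_, ?_, ?_, ?_, ?_, ?_⟩
    · have : blockWord p m rp rm (L ++ [h]) = blockWord p m rp rm L ++
          (List.replicate (p h) (true, rp h) ++ List.replicate (m h) (false, rm h)) := by
        simp [blockWord]
      rw [this, reduceW, List.foldl_append, ← reduceW, e, List.foldl_append,
        foldl_redStep_plus _ _ _ _ hP hM, foldl_redStep_minus]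
      simp
    · intro e he
      rcases List.mem_append.1 he with he | he
      · exact hP e he
      · rw [List.eq_of_mem_replicate he]
    · intro e he
      rcases List.mem_append.1 he with he | he
      · exact hM e (List.mem_of_mem_take he)
      · rw [List.eq_of_mem_replicate he]
    · simp [gain_append, gain, lP, lM]
    · simp [rest_append, rest, lM]
    · by_cases hlt : M.length < p h
      · refine Or.inr ⟨h, ⟨L, [], rfl, by omega, rfl⟩, ?_⟩
        obtain ⟨k, hk⟩ := Nat.exists_eq_add_of_lt hlt
        rw [show p h - M.length = k + 1 by omega, List.replicate_succ', ← List.append_assoc]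
        simp
      · rw [show p h - M.length = 0 by omega]
        rcases hl with rfl | ⟨k, ⟨L₁, L₂, rfl, h1, h2⟩, hk⟩
        · simp
        · refine Or.inr ⟨k, ⟨L₁, L₂ ++ [h], by simp, h1, ?_⟩, by simpa using hk⟩
          rw [rest_append] at lM
          simp only [rest] at lM
          rw [show rest p m 0 L₁ - p k + m k = m k by omega] at lM
          simp only [gain_append, gain, h2]
          omega

lemma counts_blockWord (p m : ℕ → ℕ) (rp rm : ℕ → Root) (L : List ℕ) :
    plusCt (reduceW (blockWord p m rp rm L)) = gain p m 0 L ∧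
      minusCt (reduceW (blockWord p m rp rm L)) = rest p m 0 L ∧
      (0 < gain p m 0 L →
        ∃ h, LastSurvivor p m L h ∧ lastPlus (blockWord p m rp rm L) = some (rp h)) := by
  obtain ⟨P, M, e, hP, hM, lP, lM, hl⟩ := reduceW_blockWord p m rp rm L
  have f1 : P.filter (fun e => e.1) = P := List.filter_eq_self.2 (by simpa using hP)
  have f2 : M.filter (fun e => e.1) = [] := List.filter_eq_nil_iff.2 (by simpa using hM)
  have f3 : P.filter (fun e => !e.1) = [] := List.filter_eq_nil_iff.2 (by simpa using hP)
  have f4 : M.filter (fun e => !e.1) = M := List.filter_eq_self.2 (by simpa using hM)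
  refine ⟨?_, ?_, fun h0 => ?_⟩
  · simp [plusCt, e, f1, f2, lP]
  · simp [minusCt, e, f3, f4, lM]
  · rcases hl with rfl | ⟨h, hs, hh⟩
    · simp at lP; omega
    · exact ⟨h, hs, by simp [lastPlus, e, f1, f2, hh]⟩

end Reduction

section Operators

variable {n i j : ℕ} {x y : KPf}

lemma aSt_eq (n i : ℕ) (x : KPf) :
    aSt n i x = gain (fun h => x (h, i)) (fun h => x (h, i + 1)) 0 (List.range (n + 1)).reverse :=
  (counts_blockWord (fun h => x (h, i)) (fun h => x (h, i + 1)) (fun h => (h, i))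
    (fun h => (h, i + 1)) _).1

lemma aStar_eq (n i : ℕ) (x : KPf) :
    aStar n i x = gain (fun k => x (i + 1, k)) (fun k => x (i, k)) 0 (List.range (n + 1)) :=
  (counts_blockWord (fun k => x (i + 1, k)) (fun k => x (i, k)) (fun k => (i + 1, k))
    (fun k => (i, k)) _).1

lemma bStar_eq (n i : ℕ) (x : KPf) :
    bStar n i x = rest (fun k => x (i + 1, k)) (fun k => x (i, k)) 0 (List.range (n + 1)) :=
  (counts_blockWord (fun k => x (i + 1, k)) (fun k => x (i, k)) (fun k => (i + 1, k))
    (fun k => (i, k)) _).2.1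

lemma LastSurvivor.pos {p m : ℕ → ℕ} {L : List ℕ} {h : ℕ} (hs : LastSurvivor p m L h) :
    0 < p h := by
  obtain ⟨_, _, _, h1, _⟩ := hs
  omega

lemma KPmove_apply {r r' : Root} (hr : r ≠ r') (q : Root) :
    KPmove x r r' q = if q = r' then x q + 1 else if q = r then x q - 1 else x q := by
  simp only [KPmove, KPadd, KPsub]
  grind

lemma IsKP.KPmove {r r' : Root} (hx : IsKP n x) (hr : r ≠ r') (hr' : IsPos n r') :
    IsKP n (KPmove x r r') := by
  intro q hq
  rw [KPmove_apply hr] at hq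
  split_ifs at hq with h1 h2
  · exact h1 ▸ hr'
  · exact hx q (by omega)
  · exact hx q hq

/-- The two ways in which `f_i` can act. -/
lemma fop_eq_some (hx : IsKP n x) (hi : 1 ≤ i) (hn : i + 1 ≤ n) (hy : fop n i x = some y) :
    IsKP n y ∧
    ((bStar n i x < aSt n i x ∧ ∃ h, h < i ∧ 0 < x (h, i) ∧
      LastSurvivor (fun h => x (h, i)) (fun h => x (h, i + 1)) (List.range (n + 1)).reverse h ∧
      y = KPmove x (h, i) (h, i + 1)) ∨
    (aSt n i x ≤ bStar n i x ∧ 0 < aStar n i x ∧ ∃ k, i + 1 < k ∧ 0 < x (i + 1, k) ∧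
      LastSurvivor (fun k => x (i + 1, k)) (fun k => x (i, k)) (List.range (n + 1)) k ∧
      y = KPmove x (i + 1, k) (i, k))) := by
  unfold fop at hy
  split_ifs at hy with h1 h2
  · obtain ⟨h, hs, hl⟩ := (counts_blockWord (fun h => x (h, i)) (fun h => x (h, i + 1))
      (fun h => (h, i)) (fun h => (h, i + 1)) (List.range (n + 1)).reverse).2.2
      (by rw [← aSt_eq]; omega)
    change lastPlus (Wword n i x) = _ at hl
    simp only [ftilde, hl, Option.some.injEq] at hy
    have h0 : 0 < x (h, i) := hs.pos
    obtain ⟨q1, q2, q3⟩ := hx (h, i) (by omega)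
    simp only at q1 q2 q3
    subst hy
    refine ⟨hx.KPmove (by simp) ⟨q1, ?_, hn⟩, Or.inl ⟨h1, h, q2, h0, hs, rfl⟩⟩
    simp only
    omega
  · obtain ⟨k, hs, hl⟩ := (counts_blockWord (fun k => x (i + 1, k)) (fun k => x (i, k))
      (fun k => (i + 1, k)) (fun k => (i, k)) (List.range (n + 1))).2.2
      (by rw [← aStar_eq]; omega)
    change lastPlus (Wstar n i x) = _ at hl
    simp only [ftildeS, hl, Option.some.injEq] at hy
    have h0 : 0 < x (i + 1, k) := hs.pos
    obtain ⟨q1, q2, q3⟩ := hx (i + 1, k) (by omega)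
    simp only at q1 q2 q3
    subst hy
    refine ⟨hx.KPmove (by simp) ⟨hi, ?_, q3⟩, Or.inr ⟨by omega, h2, k, q2, h0, hs, rfl⟩⟩
    simp only
    omega

lemma nodup_reverse_range (n : ℕ) : (List.range n).reverse.Nodup :=
  List.nodup_reverse.2 List.nodup_range

lemma fop_eq_none_iff : fop n i x = none ↔ aSt n i x - bStar n i x + aStar n i x = 0 := by
  unfold fop ftilde ftildeS
  split_ifs with h1 h2
  · split <;> simp <;> omega
  · split <;> simp <;> omega
  · simp; omega

lemma fop_stats (hx : IsKP n x) (hi : 1 ≤ i) (hn : i + 1 ≤ n) (hy : fop n i x = some y) :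
    aSt n i y - bStar n i y + aStar n i y + 1 = aSt n i x - bStar n i x + aStar n i x := by
  obtain ⟨-, ⟨h1, h, hlt, h0, hs, rfl⟩ | ⟨h1, h2, k, hlt, h0, hs, rfl⟩⟩ := fop_eq_some hx hi hn hy
  · have e := hs.move (p' := fun k => KPmove x (h, i) (h, i + 1) (k, i))
      (m' := fun k => KPmove x (h, i) (h, i + 1) (k, i + 1)) (nodup_reverse_range _)
      (by simp [KPmove_apply]; omega) (by simp [KPmove_apply])
      (fun k hk => by simp [KPmove_apply, hk])
    have e' := gain_rest_congr (p := fun k => x (i + 1, k)) (m := fun k => x (i, k))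
      (p' := fun k => KPmove x (h, i) (h, i + 1) (i + 1, k))
      (m' := fun k => KPmove x (h, i) (h, i + 1) (i, k)) (L := List.range (n + 1))
      (fun k _ => by simp [KPmove_apply]; grind) 0
    rw [← aSt_eq, ← aSt_eq] at e
    rw [← aStar_eq, ← aStar_eq, ← bStar_eq, ← bStar_eq] at e'
    omega
  · have e := hs.move (p' := fun q => KPmove x (i + 1, k) (i, k) (i + 1, q))
      (m' := fun q => KPmove x (i + 1, k) (i, k) (i, q)) List.nodup_range
      (by simp [KPmove_apply]; omega) (by simp [KPmove_apply])
      (fun k hk => by simp [KPmove_apply, hk])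
    have e' := gain_rest_congr (p := fun q => x (q, i)) (m := fun q => x (q, i + 1))
      (p' := fun q => KPmove x (i + 1, k) (i, k) (q, i))
      (m' := fun q => KPmove x (i + 1, k) (i, k) (q, i + 1)) (L := (List.range (n + 1)).reverse)
      (fun q _ => by simp [KPmove_apply]; grind) 0
    rw [← aSt_eq, ← aSt_eq] at e'
    rw [← aStar_eq, ← aStar_eq, ← bStar_eq, ← bStar_eq] at e
    omega

lemma iterO_fop_ne_none_iff (hi : 1 ≤ i) (hn : i + 1 ≤ n) (k : ℕ) (hx : IsKP n x) :
    iterO (fop n i) k x ≠ none ↔ k ≤ aSt n i x - bStar n i x + aStar n i x := by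
  induction k generalizing x with
  | zero => simp [iterO]
  | succ k ih =>
    rw [iterO]
    cases hy : fop n i x with
    | none =>
      have := fop_eq_none_iff.1 hy
      simp; omega
    | some y =>
      have := fop_stats hx hi hn hy
      rw [Option.bind_some, ih (fop_eq_some hx hi hn hy).1]
      omega

lemma phiS_eq (hi : 1 ≤ i) (hn : i + 1 ≤ n) (hx : IsKP n x) :
    phiS n i x = aSt n i x - bStar n i x + aStar n i x := by
  have : {k | iterO (fop n i) k x ≠ none} = Set.Iic (aSt n i x - bStar n i x + aStar n i x) :=
    Set.ext fun k => iterO_fop_ne_none_iff hi hn k hx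
  rw [phiS, this, csSup_Iic]

lemma range_eq_append_adjacent (hn : i + 1 ≤ n) :
    ∃ R₁ R₂, List.range (n + 1) = R₁ ++ i :: (i + 1) :: R₂ := by
  obtain ⟨d, rfl⟩ := Nat.exists_eq_add_of_le hn
  refine ⟨List.range i, (List.range d).map (i + 2 + ·), ?_⟩
  rw [show i + 1 + d + 1 = i + 2 + d by omega, List.range_add, List.range_succ, List.range_succ]
  simp

/-- For orthogonal `i` and `j`, `f_i` does not change the statistics controlling `f_j`. -/
lemma fop_stats_orthogonal (hx : IsKP n x) (hi : 1 ≤ i) (hn : i + 1 ≤ n) (hjn : j + 1 ≤ n)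
    (hij : i + 1 < j ∨ j + 1 < i) (hy : fop n i x = some y) :
    aSt n j y = aSt n j x ∧ aStar n j y = aStar n j x ∧ bStar n j y = bStar n j x := by
  rw [aSt_eq, aSt_eq, aStar_eq, aStar_eq, bStar_eq, bStar_eq]
  obtain ⟨R₁, R₂, hRj⟩ := range_eq_append_adjacent hjn
  obtain ⟨S₁, S₂, hRi⟩ := range_eq_append_adjacent hn
  have hRj' : (List.range (n + 1)).reverse = R₂.reverse ++ (j + 1) :: j :: R₁.reverse := by
    simp [hRj]
  have hRi' : (List.range (n + 1)).reverse = S₂.reverse ++ (i + 1) :: i :: S₁.reverse := by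
    simp [hRi]
  have hnd := List.nodup_range (n := n + 1)
  have hnd' := nodup_reverse_range (n + 1)
  obtain ⟨-, ⟨-, h, hlt, h0, hs, rfl⟩ | ⟨-, -, k, hlt, h0, hs, rfl⟩⟩ := fop_eq_some hx hi hn hy
  · refine ⟨(gain_rest_congr (fun k _ => ?_) 0).1, ?_⟩
    · simp [KPmove_apply]; grind
    by_cases hh : h = j ∨ h = j + 1
    · rw [hRj'] at hs hnd'
      have hadj := hs.adjacent hnd'
      rw [hRi] at hnd ⊢
      refine gain_rest_of_adjacent hnd (fun k h1 h2 => ?_) ?_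
      · simp [KPmove_apply, h1, h2]
      · rcases hh with rfl | rfl
        · have := hadj.2 rfl
          right
          simp [KPmove_apply]
          omega
        · have := hadj.1 rfl
          left
          simp [KPmove_apply]
          omega
    · refine gain_rest_congr (fun k _ => ?_) 0
      simp [KPmove_apply]; grind
  · refine ⟨?_, gain_rest_congr (fun q _ => ?_) 0⟩
    · by_cases hh : k = j ∨ k = j + 1
      · rw [hRj] at hs hnd
        have hadj := hs.adjacent hnd
        rw [hRi'] at hnd' ⊢
        refine (gain_rest_of_adjacent hnd' (fun k h1 h2 => ?_) ?_).1
        · simp [KPmove_apply, h1, h2]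
        · rcases hh with rfl | rfl
          · have := hadj.1 rfl
            left
            simp [KPmove_apply]
            omega
          · have := hadj.2 rfl
            right
            simp [KPmove_apply]
            omega
      · refine (gain_rest_congr (fun q _ => ?_) 0).1
        simp [KPmove_apply]; grind
    · simp [KPmove_apply]; grind

end Operators

end KFC

open KFC in
/-- Stembridge axiom S1' (orthogonal case) for the modified operators:
if `|i−j| > 1` and `f_i(x) ≠ 0`, then `φ_j(f_i(x)) = φ_j(x)`. -/
theorem stmt12 (n : ℕ) (hn : 2 ≤ n) (i j : ℕ)
    (hi1 : 1 ≤ i) (hi2 : i ≤ n - 1) (hj1 : 1 ≤ j) (hj2 : j ≤ n - 1) (hij : i + 1 < j ∨ j + 1 < i)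
    (x : KPf) (hx : IsKP n x) (hf : fop n i x ≠ none) :
    phiO n j (fop n i x) = phiS n j x := by
  obtain ⟨y, hy⟩ := Option.ne_none_iff_exists'.1 hf
  obtain ⟨h1, h2, h3⟩ := fop_stats_orthogonal hx hi1 (by omega) (by omega) hij hy
  rw [hy]
  change phiS n j y = _
  rw [phiS_eq hj1 (by omega) (fop_eq_some hx hi1 (by omega) hy).1, phiS_eq hj1 (by omega) hx,
    h1, h2, h3]
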